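/- Let f(x) = wᵀx + b be a linear classifier on ℝ^d with w ≠ 0, let μ be a probability measure on ℝ^d such that Δ_adv(·;f) and Δ_unif,ε(·;f) are μ-integrable, and let ε ∈ (0, 1/12). Then ρ_unif,ε(f) ≥ max(C₁(ε) √d, 1) · ρ_adv(f), where C₁(ε) = (2 ln(2/ε))^{−1/2}. -/

import Mathlib

open MeasureTheory Metric
open scoped RealInnerProductSpace ENNReal

/-- The minimal norm of an adversarial perturbation flipping the sign of `f` at `x`:
`Δ_adv(x; f) = inf {‖r‖₂ : f(x)·f(x+r) ≤ 0}`. -/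
noncomputable def deltaAdv {d : ℕ} (f : EuclideanSpace ℝ (Fin d) → ℝ)
    (x : EuclideanSpace ℝ (Fin d)) : ℝ :=
  sInf {t : ℝ | ∃ r : EuclideanSpace ℝ (Fin d), ‖r‖ = t ∧ f x * f (x + r) ≤ 0}

/-- The uniform (rotation-invariant) probability measure on the sphere of radius `η`
centered at `0` in `ℝ^d`, viewed as a measure on the ambient space. -/
noncomputable def unifSphere (d : ℕ) (η : ℝ) : Measure (EuclideanSpace ℝ (Fin d)) :=
  ((volume : Measure (EuclideanSpace ℝ (Fin d))).toSphere Set.univ)⁻¹ •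
    Measure.map
      (fun z : Metric.sphere (0 : EuclideanSpace ℝ (Fin d)) 1 =>
        η • (z : EuclideanSpace ℝ (Fin d)))
      (volume : Measure (EuclideanSpace ℝ (Fin d))).toSphere

/-- Robustness to random uniform noise at `x`:
`Δ_unif,ε(x; f) = sup {η ≥ 0 : P_{n ~ η𝕊}(f(x) f(x+n) ≤ 0) ≤ ε}`. -/
noncomputable def deltaUnif {d : ℕ} (f : EuclideanSpace ℝ (Fin d) → ℝ) (ε : ℝ)
    (x : EuclideanSpace ℝ (Fin d)) : ℝ :=
  sSup {η : ℝ | 0 ≤ η ∧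
    unifSphere d η {n | f x * f (x + n) ≤ 0} ≤ ENNReal.ofReal ε}

/-- The part of the open unit ball lying over the points of the sphere of radius `η` at which
adding the noise changes the sign of an affine function with value `a` and gradient `w`. -/
def flipCone {d : ℕ} (w : EuclideanSpace ℝ (Fin d)) (a η : ℝ) : Set (EuclideanSpace ℝ (Fin d)) :=
  {y | y ≠ 0 ∧ ‖y‖ < 1 ∧ a * (a * ‖y‖ + η * ⟪w, y⟫) ≤ 0}

lemma volume_unitBall_ne_zero (d : ℕ) :
    volume (ball (0 : EuclideanSpace ℝ (Fin d)) 1) ≠ 0 :=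
  (measure_ball_pos volume _ one_pos).ne'

lemma volume_unitBall_ne_top (d : ℕ) :
    volume (ball (0 : EuclideanSpace ℝ (Fin d)) 1) ≠ ∞ :=
  measure_ball_lt_top.ne

open scoped Pointwise in
lemma unifSphere_flip_eq {d : ℕ} (hd : 0 < d) (w x : EuclideanSpace ℝ (Fin d)) (b η : ℝ) :
    unifSphere d η {n | (⟪w, x⟫ + b) * (⟪w, x + n⟫ + b) ≤ 0} =
      (volume (ball (0 : EuclideanSpace ℝ (Fin d)) 1))⁻¹ *
        volume (flipCone w (⟪w, x⟫ + b) η) := by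
  have hS : MeasurableSet {n : EuclideanSpace ℝ (Fin d) |
      (⟪w, x⟫ + b) * (⟪w, x + n⟫ + b) ≤ 0} :=
    (isClosed_le (by fun_prop) continuous_const).measurableSet
  have hm : Measurable (fun z : Metric.sphere (0 : EuclideanSpace ℝ (Fin d)) 1 =>
      η • (z : EuclideanSpace ℝ (Fin d))) := by fun_prop
  have hcone : Set.Ioo (0 : ℝ) 1 • ((Subtype.val :
      Metric.sphere (0 : EuclideanSpace ℝ (Fin d)) 1 → EuclideanSpace ℝ (Fin d)) ''
      ((fun z : Metric.sphere (0 : EuclideanSpace ℝ (Fin d)) 1 =>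
        η • (z : EuclideanSpace ℝ (Fin d))) ⁻¹' {n : EuclideanSpace ℝ (Fin d) |
      (⟪w, x⟫ + b) * (⟪w, x + n⟫ + b) ≤ 0})) = flipCone w (⟪w, x⟫ + b) η := by
    ext y
    simp only [Set.mem_smul, flipCone, Set.mem_image, Set.mem_preimage, Set.mem_ofPred_eq]
    constructor
    · rintro ⟨r, ⟨hr0, hr1⟩, _, ⟨⟨z, hz⟩, h, rfl⟩, rfl⟩
      have hz1 : ‖z‖ = 1 := by simpa using hz
      have hz0 : z ≠ 0 := by rintro rfl; simp at hz1
      refine ⟨smul_ne_zero hr0.ne' hz0, ?_, ?_⟩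
      · rw [norm_smul, hz1, Real.norm_of_nonneg hr0.le]; linarith
      · rw [norm_smul, hz1, Real.norm_of_nonneg hr0.le, inner_smul_right]
        simp only [inner_add_right, inner_smul_right] at h
        nlinarith [mul_nonpos_of_nonneg_of_nonpos hr0.le h]
    · rintro ⟨hy0, hy1, h⟩
      have hn : 0 < ‖y‖ := norm_pos_iff.2 hy0
      refine ⟨‖y‖, ⟨hn, hy1⟩, ‖y‖⁻¹ • y,
        ⟨⟨‖y‖⁻¹ • y, by simp [norm_smul, hn.ne']⟩, ?_, rfl⟩, ?_⟩
      · simp only [inner_add_right, inner_smul_right]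
        have h' := mul_nonpos_of_nonneg_of_nonpos (inv_pos.2 hn).le h
        calc _ = ‖y‖⁻¹ * ((⟪w, x⟫ + b) * ((⟪w, x⟫ + b) * ‖y‖ + η * ⟪w, y⟫)) := by
              field_simp; ring
          _ ≤ 0 := h'
      · rw [smul_smul, mul_inv_cancel₀ hn.ne', one_smul]
  have hd0 : (d : ℝ≥0∞) ≠ 0 := by exact_mod_cast hd.ne'
  rw [unifSphere, Measure.smul_apply, Measure.map_apply hm hS,
    Measure.toSphere_apply' _ (hm hS), hcone, Measure.toSphere_apply_univ, smul_eq_mul,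
    finrank_euclideanSpace_fin,
    ENNReal.mul_inv (Or.inl hd0) (Or.inl (ENNReal.natCast_ne_top d)), mul_comm (d : ℝ≥0∞)⁻¹,
    mul_assoc, ← mul_assoc (d : ℝ≥0∞)⁻¹,
    ENNReal.inv_mul_cancel hd0 (ENNReal.natCast_ne_top d), one_mul]

lemma unifSphere_flip_le_iff {d : ℕ} (hd : 0 < d) (w x : EuclideanSpace ℝ (Fin d)) (b η : ℝ)
    (p : ℝ≥0∞) :
    unifSphere d η {n | (⟪w, x⟫ + b) * (⟪w, x + n⟫ + b) ≤ 0} ≤ p ↔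
      volume (flipCone w (⟪w, x⟫ + b) η) ≤
        p * volume (ball (0 : EuclideanSpace ℝ (Fin d)) 1) := by
  rw [unifSphere_flip_eq hd, mul_comm, ← div_eq_mul_inv,
    ENNReal.div_le_iff (volume_unitBall_ne_zero d) (volume_unitBall_ne_top d)]

/-- A spherical cone with apex at the origin is contained in a small ball. -/
lemma exists_closedBall_of_cone {E : Type*} [NormedAddCommGroup E] [InnerProductSpace ℝ E]
    {v : E} (hv : ‖v‖ = 1) {t : ℝ} (ht0 : 0 ≤ t) (ht1 : t ≤ 1) :
    ∃ (c : E) (r : ℝ), 0 ≤ r ∧ r ≤ Real.exp (-t ^ 2 / 2) ∧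
      ∀ y : E, ‖y‖ ≤ 1 → t * ‖y‖ ≤ ⟪v, y⟫ → y ∈ closedBall c r := by
  have hexp : Real.exp (-t ^ 2 / 2) ^ 2 = Real.exp (-t ^ 2) := by
    rw [← Real.exp_nat_mul]; congr 1; push_cast; ring
  have hdist (y : E) (s : ℝ) : ‖y - s • v‖ ^ 2 = ‖y‖ ^ 2 - 2 * s * ⟪v, y⟫ + s ^ 2 := by
    rw [norm_sub_sq_real, inner_smul_right, norm_smul, hv, real_inner_comm, mul_one,
      Real.norm_eq_abs, sq_abs]
    ring
  rcases le_or_gt (t ^ 2) (1 / 2) with h | h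
  · refine ⟨t • v, √(1 - t ^ 2), Real.sqrt_nonneg _, ?_, fun y hy hty => ?_⟩
    · refine Real.sqrt_le_iff.2 ⟨(Real.exp_pos _).le, ?_⟩
      rw [hexp]
      linarith [Real.add_one_le_exp (-t ^ 2)]
    · rw [mem_closedBall, dist_eq_norm]
      refine Real.le_sqrt_of_sq_le ?_
      rw [hdist]
      have h1 := mul_le_mul_of_nonneg_left hty ht0
      nlinarith [mul_nonneg (sub_nonneg.2 hy) (by linarith [norm_nonneg y] :
        0 ≤ 1 + ‖y‖ - 2 * t ^ 2)]
  · have ht : 0 < t := by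
      rcases ht0.eq_or_lt with rfl | h0
      · norm_num at h
      · exact h0
    refine ⟨(1 / (2 * t)) • v, 1 / (2 * t), by positivity, ?_, fun y hy hty => ?_⟩
    · refine (pow_le_pow_iff_left₀ (by positivity) (by positivity) two_ne_zero).1 ?_
      rw [hexp, Real.exp_neg, div_pow, one_pow, one_div]
      refine inv_anti₀ (Real.exp_pos _) ?_
      have ht2 : t ^ 2 ≤ 1 := pow_le_one₀ ht0 ht1
      have := (abs_le.1 (Real.abs_exp_sub_one_sub_id_le (x := t ^ 2)
        (by rwa [abs_of_nonneg (sq_nonneg t)]))).2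
      nlinarith
    · rw [mem_closedBall, dist_eq_norm]
      refine (pow_le_pow_iff_left₀ (by positivity) (by positivity) two_ne_zero).1 ?_
      rw [hdist]
      have h1 : ‖y‖ ≤ ⟪v, y⟫ / t := by rw [le_div_iff₀ ht]; linarith
      have h2 : 2 * (1 / (2 * t)) * ⟪v, y⟫ = ⟪v, y⟫ / t := by field_simp
      rw [h2]
      nlinarith [norm_nonneg y]

lemma volume_cone_le {d : ℕ} {v : EuclideanSpace ℝ (Fin d)} (hv : ‖v‖ = 1)
    {t : ℝ} (ht : 0 ≤ t) :
    volume {y : EuclideanSpace ℝ (Fin d) | y ≠ 0 ∧ ‖y‖ < 1 ∧ t * ‖y‖ ≤ ⟪v, y⟫} ≤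
      ENNReal.ofReal (Real.exp (-(d * t ^ 2) / 2)) *
        volume (ball (0 : EuclideanSpace ℝ (Fin d)) 1) := by
  rcases le_or_gt t 1 with ht1 | ht1
  · obtain ⟨c, r, hr0, hr, hsub⟩ := exists_closedBall_of_cone hv ht ht1
    calc _ ≤ volume (closedBall c r) :=
          measure_mono fun y hy => hsub y hy.2.1.le hy.2.2
      _ = ENNReal.ofReal (r ^ d) * volume (ball (0 : EuclideanSpace ℝ (Fin d)) 1) := by
          rw [Measure.addHaar_closedBall _ _ hr0, finrank_euclideanSpace_fin]
      _ ≤ _ := by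
          gcongr
          calc r ^ d ≤ Real.exp (-t ^ 2 / 2) ^ d := by gcongr
            _ = _ := by rw [← Real.exp_nat_mul]; congr 1; ring
  · have : {y : EuclideanSpace ℝ (Fin d) | y ≠ 0 ∧ ‖y‖ < 1 ∧ t * ‖y‖ ≤ ⟪v, y⟫} = ∅ := by
      refine Set.eq_empty_of_forall_notMem fun y ⟨hy0, _, hy⟩ => ?_
      have h1 := real_inner_le_norm v y
      rw [hv, one_mul] at h1
      nlinarith [norm_pos_iff.2 hy0]
    simp [this]

lemma flipCone_subset_cone {d : ℕ} {w : EuclideanSpace ℝ (Fin d)} (hw : w ≠ 0) {a η : ℝ}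
    (ha : a ≠ 0) (hη : 0 < η) :
    ∃ v : EuclideanSpace ℝ (Fin d), ‖v‖ = 1 ∧
      flipCone w a η ⊆ {y | y ≠ 0 ∧ ‖y‖ < 1 ∧ |a| / ‖w‖ / η * ‖y‖ ≤ ⟪v, y⟫} := by
  have hwn : 0 < ‖w‖ := norm_pos_iff.2 hw
  have hap : 0 < |a| := abs_pos.2 ha
  refine ⟨(-(a / (|a| * ‖w‖))) • w, ?_, fun y ⟨hy0, hy1, hy⟩ => ⟨hy0, hy1, ?_⟩⟩
  · rw [norm_smul, norm_neg, norm_div, norm_mul, norm_norm, Real.norm_eq_abs,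
      Real.norm_eq_abs, abs_abs]
    field_simp
  · rw [inner_smul_left, RCLike.conj_to_real]
    have h : |a| * (|a| * ‖y‖) ≤ -(a * ⟪w, y⟫) * η := by
      rw [← mul_assoc, abs_mul_abs_self]; linarith
    have e1 : |a| / ‖w‖ / η * ‖y‖ = |a| * (|a| * ‖y‖) / (|a| * ‖w‖ * η) := by
      field_simp
    have e2 : -(a / (|a| * ‖w‖)) * ⟪w, y⟫ = -(a * ⟪w, y⟫) * η / (|a| * ‖w‖ * η) := by
      field_simp
    rw [e1, e2]
    gcongr

lemma flipCone_mono {d : ℕ} (w : EuclideanSpace ℝ (Fin d)) (a : ℝ) {η η' : ℝ} (hη : 0 ≤ η)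
    (h : η ≤ η') : flipCone w a η ⊆ flipCone w a η' := by
  rintro y ⟨hy0, hy1, hy⟩
  refine ⟨hy0, hy1, ?_⟩
  have h0 : 0 ≤ a * a * ‖y‖ := mul_nonneg (mul_self_nonneg a) (norm_nonneg y)
  rcases le_or_gt (a * ⟪w, y⟫) 0 with h1 | h1
  · nlinarith [mul_nonneg (sub_nonneg.2 h) (neg_nonneg.2 h1)]
  · have h2 : 0 ≤ η * (a * ⟪w, y⟫) := mul_nonneg hη h1.le
    have h3 : a * a * ‖y‖ = 0 := by nlinarith
    have : a ≠ 0 := by rintro rfl; simp at h1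
    have := norm_pos_iff.2 hy0
    have : 0 < a * a * ‖y‖ := by positivity
    linarith

lemma volume_unitBall_le_two_mul {d : ℕ} {u : EuclideanSpace ℝ (Fin d)} (hu : u ≠ 0) :
    volume (ball (0 : EuclideanSpace ℝ (Fin d)) 1) ≤
      2 * volume {y : EuclideanSpace ℝ (Fin d) | ‖y‖ < 1 ∧ ⟪u, y⟫ < 0} := by
  set H := {y : EuclideanSpace ℝ (Fin d) | ‖y‖ < 1 ∧ ⟪u, y⟫ < 0}
  have hker : volume ((LinearMap.ker (innerSL ℝ u).toLinearMap :
      Submodule ℝ (EuclideanSpace ℝ (Fin d))) : Set (EuclideanSpace ℝ (Fin d))) = 0 := by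
    refine Measure.addHaar_submodule _ _ fun h => hu ?_
    have : u ∈ LinearMap.ker (innerSL ℝ u).toLinearMap := h ▸ Submodule.mem_top
    simpa using this
  have hsub : ball (0 : EuclideanSpace ℝ (Fin d)) 1 ⊆ (H ∪ -H) ∪
      (LinearMap.ker (innerSL ℝ u).toLinearMap : Submodule ℝ (EuclideanSpace ℝ (Fin d))) := by
    intro y hy
    rw [mem_ball_zero_iff] at hy
    rcases lt_trichotomy (⟪u, y⟫) 0 with h | h | h
    · exact Or.inl (Or.inl ⟨hy, h⟩)
    · exact Or.inr (by simpa using h)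
    · exact Or.inl (Or.inr ⟨by rwa [norm_neg], by rw [inner_neg_right]; linarith⟩)
  calc _ ≤ volume (H ∪ -H) + 0 := hker ▸ (measure_mono hsub).trans (measure_union_le _ _)
    _ ≤ volume H + volume (-H) := by rw [add_zero]; exact measure_union_le _ _
    _ = 2 * volume H := by rw [Measure.measure_neg, two_mul]

lemma bddAbove_of_volume_flipCone_le {d : ℕ} {w : EuclideanSpace ℝ (Fin d)} (hw : w ≠ 0)
    {a ε : ℝ} (ha : a ≠ 0) (hε : ε < 1 / 2) :
    BddAbove {η : ℝ | 0 ≤ η ∧ volume (flipCone w a η) ≤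
      ENNReal.ofReal ε * volume (ball (0 : EuclideanSpace ℝ (Fin d)) 1)} := by
  by_contra hunb
  rw [not_bddAbove_iff] at hunb
  have hn (n : ℕ) : volume (flipCone w a n) ≤
      ENNReal.ofReal ε * volume (ball (0 : EuclideanSpace ℝ (Fin d)) 1) := by
    obtain ⟨η, ⟨_, h⟩, hη⟩ := hunb n
    exact (measure_mono (flipCone_mono w a n.cast_nonneg hη.le)).trans h
  have hmono : Monotone fun n : ℕ => flipCone w a n := fun m n h =>
    flipCone_mono w a m.cast_nonneg (by exact_mod_cast h)
  have hsub : {y : EuclideanSpace ℝ (Fin d) | ‖y‖ < 1 ∧ ⟪a • w, y⟫ < 0} ⊆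
      ⋃ n : ℕ, flipCone w a n := by
    rintro y ⟨hy1, hy⟩
    rw [inner_smul_left, RCLike.conj_to_real] at hy
    obtain ⟨n, hn⟩ := exists_nat_ge (a * a * ‖y‖ / -(a * ⟪w, y⟫))
    rw [div_le_iff₀ (by linarith)] at hn
    refine Set.mem_iUnion.2 ⟨n, ?_, hy1, by linarith⟩
    rintro rfl
    simp at hy
  have hhalf : volume {y : EuclideanSpace ℝ (Fin d) | ‖y‖ < 1 ∧ ⟪a • w, y⟫ < 0} ≤
      ENNReal.ofReal ε * volume (ball (0 : EuclideanSpace ℝ (Fin d)) 1) := by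
    refine (measure_mono hsub).trans ?_
    rw [hmono.measure_iUnion]
    exact iSup_le hn
  have hle : volume (ball (0 : EuclideanSpace ℝ (Fin d)) 1) ≤
      2 * ENNReal.ofReal ε * volume (ball (0 : EuclideanSpace ℝ (Fin d)) 1) := by
    refine (volume_unitBall_le_two_mul (smul_ne_zero ha hw)).trans ?_
    rw [mul_assoc]
    gcongr
  have hlt : 2 * ENNReal.ofReal ε < 1 := by
    rw [← ENNReal.ofReal_ofNat, ← ENNReal.ofReal_mul zero_le_two, ENNReal.ofReal_lt_one]
    linarith
  have := ENNReal.mul_lt_mul_left (volume_unitBall_ne_zero d) (volume_unitBall_ne_top d) hlt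
  rw [one_mul] at this
  exact absurd hle (not_le.2 this)

lemma deltaAdv_affine_le {d : ℕ} {w : EuclideanSpace ℝ (Fin d)} (hw : w ≠ 0) (b : ℝ)
    (x : EuclideanSpace ℝ (Fin d)) :
    deltaAdv (fun y => ⟪w, y⟫ + b) x ≤ |⟪w, x⟫ + b| / ‖w‖ := by
  have hwn : 0 < ‖w‖ := norm_pos_iff.2 hw
  refine csInf_le ⟨0, ?_⟩ ⟨(-((⟪w, x⟫ + b) / ‖w‖ ^ 2)) • w, ?_, ?_⟩
  · rintro _ ⟨r, rfl, _⟩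
    exact norm_nonneg r
  · rw [norm_smul, norm_neg, norm_div, norm_pow, norm_norm, Real.norm_eq_abs]
    field_simp
  · beta_reduce
    rw [inner_add_right, inner_smul_right, real_inner_self_eq_norm_sq, neg_mul,
      div_mul_cancel₀ _ (by positivity)]
    apply le_of_eq
    ring

lemma mul_le_deltaUnif_affine {d : ℕ} (hd : 0 < d) {w : EuclideanSpace ℝ (Fin d)} (hw : w ≠ 0)
    (b : ℝ) {ε : ℝ} (hε0 : 0 < ε) (hε : ε < 1 / 2) (x : EuclideanSpace ℝ (Fin d)) :
    max ((2 * Real.log (2 / ε)) ^ (-(1 / 2) : ℝ) * Real.sqrt d) 1 *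
      (|⟪w, x⟫ + b| / ‖w‖) ≤ deltaUnif (fun y => ⟪w, y⟫ + b) ε x := by
  simp only [deltaUnif, unifSphere_flip_le_iff hd]
  have hwn : 0 < ‖w‖ := norm_pos_iff.2 hw
  rcases eq_or_ne (⟪w, x⟫ + b) 0 with ha | ha
  · rw [ha, abs_zero, zero_div, mul_zero]
    exact Real.sSup_nonneg fun _ h => h.1
  generalize ⟪w, x⟫ + b = a at ha
  have hbdd := bddAbove_of_volume_flipCone_le (ε := ε) hw ha hε
  have hD : 0 < |a| / ‖w‖ := div_pos (abs_pos.2 ha) hwn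
  have hcap {η : ℝ} (hη : 0 < η) : volume (flipCone w a η) ≤
      ENNReal.ofReal (Real.exp (-(d * (|a| / ‖w‖ / η) ^ 2) / 2)) *
        volume (ball (0 : EuclideanSpace ℝ (Fin d)) 1) := by
    obtain ⟨v, hv, hsub⟩ := flipCone_subset_cone hw ha hη
    exact (measure_mono hsub).trans (volume_cone_le hv (div_pos hD hη).le)
  rw [max_mul_of_nonneg _ _ hD.le, one_mul]
  refine max_le ?_ ?_
  · have hL : 0 < 2 * Real.log (2 / ε) := by
      refine mul_pos two_pos (Real.log_pos ?_)
      rw [lt_div_iff₀ hε0]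
      linarith
    have hd' : (0 : ℝ) < d := by exact_mod_cast hd
    have hC : 0 < (2 * Real.log (2 / ε)) ^ (-(1 / 2) : ℝ) * √d := by positivity
    have hC2 : ((2 * Real.log (2 / ε)) ^ (-(1 / 2) : ℝ) * √d) ^ 2 =
        (2 * Real.log (2 / ε))⁻¹ * d := by
      rw [mul_pow, Real.sq_sqrt hd'.le, ← Real.rpow_natCast, ← Real.rpow_mul hL.le]
      norm_num [Real.rpow_neg_one]
    refine le_csSup hbdd ⟨(mul_pos hC hD).le, (hcap (mul_pos hC hD)).trans ?_⟩
    gcongr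
    have ht : |a| / ‖w‖ / ((2 * Real.log (2 / ε)) ^ (-(1 / 2) : ℝ) * √d * (|a| / ‖w‖)) =
        ((2 * Real.log (2 / ε)) ^ (-(1 / 2) : ℝ) * √d)⁻¹ := by
      rw [div_mul_cancel_right₀ hD.ne']
    have he : -((d : ℝ) * ((2 * Real.log (2 / ε))⁻¹ * d)⁻¹) / 2 = -Real.log (2 / ε) := by
      have := hL.ne'
      field_simp
    rw [ht, inv_pow, hC2, he, Real.exp_neg, Real.exp_log (by positivity), inv_div]
    linarith
  · refine le_of_forall_lt_imp_le_of_dense fun η hη => ?_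
    rcases lt_or_ge η 0 with h0 | h0
    · exact h0.le.trans (Real.sSup_nonneg fun _ h => h.1)
    refine le_csSup hbdd ⟨h0, ?_⟩
    have hempty : flipCone w a η = ∅ := by
      refine Set.eq_empty_of_forall_notMem fun y ⟨hy0, _, hy⟩ => ?_
      have hyn : 0 < ‖y‖ := norm_pos_iff.2 hy0
      have h1 : -(a * ⟪w, y⟫) ≤ |a| * (‖w‖ * ‖y‖) := by
        calc _ ≤ |a * ⟪w, y⟫| := neg_le_abs _
          _ = |a| * |⟪w, y⟫| := abs_mul _ _
          _ ≤ _ := by gcongr; exact abs_real_inner_le_norm w y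
      have h2 := mul_le_mul_of_nonneg_left h1 h0
      have h3 : η * ‖w‖ < |a| := (lt_div_iff₀ hwn).1 hη
      have h4 : η * ‖w‖ * (|a| * ‖y‖) < |a| * (|a| * ‖y‖) := by gcongr
      rw [← mul_assoc |a| |a|, abs_mul_abs_self] at h4
      linarith
    simp [hempty]

/-- **Theorem 2, Eq. (8) (lower bound on robustness to random uniform noise).**
For a linear classifier `f(x) = wᵀx + b` with `w ≠ 0` and `ε ∈ (0, 1/12)`,
`ρ_unif,ε(f) ≥ max(C₁(ε) √d, 1) ρ_adv(f)` with `C₁(ε) = (2 ln(2/ε))^{-1/2}`. -/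
theorem linear_unif_robustness_lower_bound {d : ℕ} (hd : 0 < d)
    (w : EuclideanSpace ℝ (Fin d)) (hw : w ≠ 0) (b : ℝ)
    (μ : Measure (EuclideanSpace ℝ (Fin d))) [IsProbabilityMeasure μ]
    (ε : ℝ) (hε0 : 0 < ε) (hε : ε < 1 / 12)
    (hadv : Integrable (fun x => deltaAdv (fun y => ⟪w, y⟫ + b) x) μ)
    (hunif : Integrable (fun x => deltaUnif (fun y => ⟪w, y⟫ + b) ε x) μ) :
    ∫ x, deltaUnif (fun y => ⟪w, y⟫ + b) ε x ∂μ ≥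
      max ((2 * Real.log (2 / ε)) ^ (-(1 / 2) : ℝ) * Real.sqrt d) 1 *
        ∫ x, deltaAdv (fun y => ⟪w, y⟫ + b) x ∂μ := by
  have hpos : 0 ≤ max ((2 * Real.log (2 / ε)) ^ (-(1 / 2) : ℝ) * Real.sqrt d) 1 :=
    zero_le_one.trans (le_max_right _ _)
  rw [ge_iff_le, ← integral_const_mul]
  refine integral_mono (hadv.const_mul _) hunif fun x => ?_
  exact (mul_le_mul_of_nonneg_left (deltaAdv_affine_le hw b x) hpos).trans
    (mul_le_deltaUnif_affine hd hw b hε0 (by linarith) x)
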